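/- Let μ be a probability measure on S¹ whose pushforward μ̃ to [0,2π) has a continuous density f_μ̃ bounded below away from zero, and let ν be a probability measure on S¹. Then for every θ ∈ ℝ the function C_{[μ,ν]} is differentiable at θ with derivative (d/dθ) C_{[μ,ν]}(θ) = −2 ∫₀^{2π} (T̃_θ(u) − u) du, where T̃_θ(u) := F_ν̃⁻(F_μ̃(u) − θ). -/

import Mathlib

open MeasureTheory Real Set Filter Topology

noncomputable section

instance : Fact (0 < 2 * Real.pi) := ⟨by positivity⟩

/-- The circle `ℝ / 2πℤ`. -/
abbrev S1 : Type := AddCircle (2 * Real.pi)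

/-- The quotient projection `exp_c : ℝ → S¹`. -/
def expc (x : ℝ) : S1 := (x : S1)

/-- The canonical right inverse `log_c : S¹ → [0, 2π)`. -/
def logc (z : S1) : ℝ := (AddCircle.equivIco (2 * Real.pi) 0 z : ℝ)

/-- Squared 2-Wasserstein distance: infimum of `∫ d(x,y)² dγ` over couplings `γ`. -/
def W2sq {X : Type*} [MeasurableSpace X] [PseudoMetricSpace X]
    (μ ν : Measure X) : ℝ :=
  sInf { c : ℝ | ∃ γ : Measure (X × X), IsProbabilityMeasure γ ∧
      γ.map Prod.fst = μ ∧ γ.map Prod.snd = ν ∧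
      c = ∫ p, dist p.1 p.2 ^ 2 ∂γ }

/-- `T` is an optimal transport map from `μ` to `ν`. -/
def IsOTM (μ ν : Measure S1) (T : S1 → S1) : Prop :=
  Measurable T ∧ μ.map T = ν ∧ (∫ z, dist z (T z) ^ 2 ∂μ) = W2sq μ ν

/-- `μ̃`, the pushforward of a measure on `S¹` to `[0, 2π) ⊆ ℝ` via `log_c`. -/
def tilde (μ : Measure S1) : Measure ℝ := μ.map logc

/-- The periodic cumulative distribution function of a (periodicised) measure on `[0,2π)`:
`F(x) = μ̃([0,x))` for `x ∈ [0,2π]`, extended by `F(x + 2π) = F(x) + 1`. -/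
def cdf (μt : Measure ℝ) (x : ℝ) : ℝ :=
  ⌊x / (2 * π)⌋ + (μt (Set.Ico 0 (Int.fract (x / (2 * π)) * (2 * π)))).toReal

/-- The quantile function (generalized inverse) of the periodic cdf. -/
def qf (μt : Measure ℝ) (u : ℝ) : ℝ := sInf { x : ℝ | u ≤ cdf μt x }

/-- The cost `C_{[μ,ν]}(θ) = ∫₀¹ (F_μ̃⁻(u) − F_ν̃⁻(u−θ))² du`. -/
def cost (μ ν : Measure S1) (θ : ℝ) : ℝ :=
  ∫ u in (0:ℝ)..1, (qf (tilde μ) u - qf (tilde ν) (u - θ)) ^ 2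


lemma measurable_logc : Measurable logc :=
  measurable_subtype_coe.comp (AddCircle.measurableEquivIco (2 * π) 0).measurable

lemma isProbabilityMeasure_tilde (μ : Measure S1) [IsProbabilityMeasure μ] :
    IsProbabilityMeasure (tilde μ) :=
  Measure.isProbabilityMeasure_map measurable_logc.aemeasurable

lemma cdf_add_two_pi (m : Measure ℝ) (x : ℝ) : cdf m (x + 2 * π) = cdf m x + 1 := by
  have h : (x + 2 * π) / (2 * π) = x / (2 * π) + 1 := by field_simp
  simp only [cdf, h, Int.floor_add_one, Int.fract_add_one]
  push_cast
  ring

lemma floor_le_cdf (m : Measure ℝ) (x : ℝ) : (⌊x / (2 * π)⌋ : ℝ) ≤ cdf m x :=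
  le_add_of_nonneg_right ENNReal.toReal_nonneg

lemma cdf_le (m : Measure ℝ) [IsProbabilityMeasure m] (x : ℝ) : cdf m x ≤ x / (2 * π) + 1 :=
  add_le_add (Int.floor_le _) measureReal_le_one

lemma superlevel_cdf_nonempty (m : Measure ℝ) (u : ℝ) : {x : ℝ | u ≤ cdf m x}.Nonempty := by
  refine ⟨2 * π * (u + 1), le_trans ?_ (floor_le_cdf m _)⟩
  rw [mul_div_cancel_left₀ _ (by positivity), Int.floor_add_one]
  push_cast
  exact (Int.lt_floor_add_one u).le

lemma superlevel_cdf_bddBelow (m : Measure ℝ) [IsProbabilityMeasure m] (u : ℝ) :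
    BddBelow {x : ℝ | u ≤ cdf m x} := by
  refine ⟨(u - 1) * (2 * π), fun x hx => ?_⟩
  have h : u ≤ x / (2 * π) + 1 := le_trans hx (cdf_le m x)
  rw [← le_div_iff₀ (by positivity)]
  linarith

lemma monotone_qf (m : Measure ℝ) [IsProbabilityMeasure m] : Monotone (qf m) :=
  fun u _ huv => csInf_le_csInf (superlevel_cdf_bddBelow m u) (superlevel_cdf_nonempty m _)
    fun _ hx => le_trans huv hx

lemma qf_add_one (m : Measure ℝ) [IsProbabilityMeasure m] (u : ℝ) :
    qf m (u + 1) = qf m u + 2 * π := by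
  apply le_antisymm
  · rw [← sub_le_iff_le_add]
    refine le_csInf (superlevel_cdf_nonempty m u) fun x hx => ?_
    rw [sub_le_iff_le_add]
    refine csInf_le (superlevel_cdf_bddBelow m _) ?_
    rw [mem_ofPred_eq, cdf_add_two_pi]
    exact add_le_add_left hx 1
  · refine le_csInf (superlevel_cdf_nonempty m _) fun x hx => ?_
    rw [← le_sub_iff_add_le]
    refine csInf_le (superlevel_cdf_bddBelow m _) ?_
    have h := cdf_add_two_pi m (x - 2 * π)
    rw [sub_add_cancel] at h
    rw [mem_ofPred_eq] at hx ⊢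
    linarith

/-- The quantile function is a left inverse of a strictly increasing distribution function. -/
lemma qf_cdf_of_strictMono {m : Measure ℝ} (h : StrictMono (cdf m)) (x : ℝ) :
    qf m (cdf m x) = x := by
  have : {y : ℝ | cdf m x ≤ cdf m y} = Ici x := by
    ext y
    exact h.le_iff_le
  rw [qf, this, csInf_Ici]

section Density

variable {m : Measure ℝ} {f : ℝ → ℝ} {c : ℝ}

lemma cdf_eq_floor_add_integral (hf : Continuous f) (hc : 0 ≤ c)
    (hfb : ∀ x ∈ Ico (0:ℝ) (2 * π), c ≤ f x)
    (hm : m = (volume.restrict (Ico (0:ℝ) (2 * π))).withDensity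
      (fun x => ENNReal.ofReal (f x))) (x : ℝ) :
    cdf m x = ⌊x / (2 * π)⌋ + ∫ t in (0:ℝ)..Int.fract (x / (2 * π)) * (2 * π), f t := by
  have hpi : 0 < 2 * π := by positivity
  have ha0 : 0 ≤ Int.fract (x / (2 * π)) * (2 * π) := mul_nonneg (Int.fract_nonneg _) hpi.le
  have ha1 : Int.fract (x / (2 * π)) * (2 * π) ≤ 2 * π :=
    mul_le_of_le_one_left hpi.le (Int.fract_lt_one _).le
  rw [cdf]
  generalize Int.fract (x / (2 * π)) * (2 * π) = a at ha0 ha1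
  have hsub : Ico 0 a ⊆ Ico 0 (2 * π) := Ico_subset_Ico_right ha1
  rw [hm, withDensity_apply _ measurableSet_Ico, Measure.restrict_restrict measurableSet_Ico,
    inter_eq_left.mpr hsub, intervalIntegral.integral_of_le ha0, ← integral_Ico_eq_integral_Ioc,
    integral_eq_lintegral_of_nonneg_ae ?_ hf.aestronglyMeasurable]
  exact (ae_restrict_iff' measurableSet_Ico).mpr
    (ae_of_all _ fun t ht => hc.trans (hfb t (hsub ht)))

lemma integral_density_eq_one [IsProbabilityMeasure m] (hf : Continuous f) (hc : 0 ≤ c)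
    (hfb : ∀ x ∈ Ico (0:ℝ) (2 * π), c ≤ f x)
    (hm : m = (volume.restrict (Ico (0:ℝ) (2 * π))).withDensity
      (fun x => ENNReal.ofReal (f x))) :
    ∫ t in (0:ℝ)..2 * π, f t = 1 := by
  have h1 : m univ = 1 := measure_univ
  rw [hm, withDensity_apply _ MeasurableSet.univ, Measure.restrict_univ] at h1
  rw [intervalIntegral.integral_of_le (by positivity), ← integral_Ico_eq_integral_Ioc,
    integral_eq_lintegral_of_nonneg_ae ?_ hf.aestronglyMeasurable, h1, ENNReal.toReal_one]
  exact (ae_restrict_iff' measurableSet_Ico).mpr (ae_of_all _ fun t ht => hc.trans (hfb t ht))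

lemma mul_sub_le_integral (hf : Continuous f) (hfb : ∀ x ∈ Ico (0:ℝ) (2 * π), c ≤ f x)
    {a b : ℝ} (ha : 0 ≤ a) (hab : a ≤ b) (hb : b ≤ 2 * π) :
    c * (b - a) ≤ ∫ t in a..b, f t := by
  have h := intervalIntegral.integral_mono_on_of_le_Ioo (f := fun _ => c) (g := f)
    (μ := volume) hab
    (intervalIntegrable_const) (hf.intervalIntegrable a b)
    fun x hx => hfb x ⟨ha.trans hx.1.le, hx.2.trans_le hb⟩
  rwa [intervalIntegral.integral_const, smul_eq_mul, mul_comm] at h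

lemma mul_sub_le_cdf_sub [IsProbabilityMeasure m] (hf : Continuous f) (hc : 0 ≤ c)
    (hfb : ∀ x ∈ Ico (0:ℝ) (2 * π), c ≤ f x)
    (hm : m = (volume.restrict (Ico (0:ℝ) (2 * π))).withDensity
      (fun x => ENNReal.ofReal (f x))) {x y : ℝ} (hxy : x ≤ y) :
    c * (y - x) ≤ cdf m y - cdf m x := by
  have hpi : 0 < 2 * π := by positivity
  have hone := integral_density_eq_one hf hc hfb hm
  rw [cdf_eq_floor_add_integral hf hc hfb hm, cdf_eq_floor_add_integral hf hc hfb hm]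
  have hdecomp (z : ℝ) : z = ⌊z / (2 * π)⌋ * (2 * π) + Int.fract (z / (2 * π)) * (2 * π) := by
    rw [← add_mul, Int.floor_add_fract, div_mul_cancel₀ _ hpi.ne']
  have hnonneg (z : ℝ) : 0 ≤ Int.fract (z / (2 * π)) * (2 * π) :=
    mul_nonneg (Int.fract_nonneg _) hpi.le
  have hle (z : ℝ) : Int.fract (z / (2 * π)) * (2 * π) ≤ 2 * π :=
    mul_le_of_le_one_left hpi.le (Int.fract_lt_one _).le
  have hfloor : ⌊x / (2 * π)⌋ ≤ ⌊y / (2 * π)⌋ := Int.floor_mono (by gcongr)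
  have hx := hdecomp x
  have hy := hdecomp y
  have hx0 := hnonneg x
  have hy0 := hnonneg y
  have hx1 := hle x
  have hy1 := hle y
  generalize Int.fract (x / (2 * π)) * (2 * π) = a at *
  generalize Int.fract (y / (2 * π)) * (2 * π) = b at *
  generalize ⌊x / (2 * π)⌋ = k at *
  generalize ⌊y / (2 * π)⌋ = n at *
  have hii (s t : ℝ) : IntervalIntegrable f volume s t := hf.intervalIntegrable s t
  rcases hfloor.eq_or_lt with rfl | hlt
  · have h := mul_sub_le_integral hf hfb hx0 (show a ≤ b by linarith) hy1
    rw [← intervalIntegral.integral_interval_sub_left (hii 0 b) (hii 0 a)] at h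
    rw [hx, hy]
    linarith
  · have h1 := mul_sub_le_integral hf hfb le_rfl hy0 hy1
    have h2 := mul_sub_le_integral hf hfb hx0 hx1 le_rfl
    have h3 := mul_sub_le_integral hf hfb le_rfl hpi.le le_rfl
    rw [← intervalIntegral.integral_interval_sub_left (hii 0 _) (hii 0 a)] at h2
    rw [hone] at h2 h3
    have hkn : (0 : ℝ) ≤ n - k - 1 := by
      have : (k : ℝ) + 1 ≤ n := by exact_mod_cast hlt
      linarith
    have h4 := mul_nonneg hkn (sub_nonneg.mpr h3)
    rw [hx, hy]
    linarith

lemma strictMono_cdf [IsProbabilityMeasure m] (hf : Continuous f) (hc : 0 < c)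
    (hfb : ∀ x ∈ Ico (0:ℝ) (2 * π), c ≤ f x)
    (hm : m = (volume.restrict (Ico (0:ℝ) (2 * π))).withDensity
      (fun x => ENNReal.ofReal (f x))) : StrictMono (cdf m) := by
  intro x y hxy
  have h := mul_sub_le_cdf_sub hf hc.le hfb hm hxy.le
  have := mul_pos hc (sub_pos.mpr hxy)
  linarith

lemma surjective_cdf [IsProbabilityMeasure m] (hf : Continuous f) (hc : 0 ≤ c)
    (hfb : ∀ x ∈ Ico (0:ℝ) (2 * π), c ≤ f x)
    (hm : m = (volume.restrict (Ico (0:ℝ) (2 * π))).withDensity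
      (fun x => ENNReal.ofReal (f x))) : Function.Surjective (cdf m) := by
  intro u
  have hpi : 0 < 2 * π := by positivity
  have hone := integral_density_eq_one hf hc hfb hm
  obtain ⟨a, ha, hau⟩ := intermediate_value_Icc hpi.le
    (f := fun x => ∫ t in (0:ℝ)..x, f t)
    (intervalIntegral.continuous_primitive hf.intervalIntegrable 0).continuousOn
    (show Int.fract u ∈ _ by
      simp only [intervalIntegral.integral_same, hone]
      exact ⟨Int.fract_nonneg u, (Int.fract_lt_one u).le⟩)
  have ha' : a < 2 * π := by
    refine lt_of_le_of_ne ha.2 ?_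
    rintro rfl
    exact (Int.fract_lt_one u).ne (hau.symm.trans hone)
  have hb : a / (2 * π) ∈ Ico (0:ℝ) 1 :=
    ⟨div_nonneg ha.1 hpi.le, (div_lt_one hpi).mpr ha'⟩
  refine ⟨a + ⌊u⌋ * (2 * π), ?_⟩
  have hdiv : (a + ⌊u⌋ * (2 * π)) / (2 * π) = a / (2 * π) + ⌊u⌋ := by field_simp
  rw [cdf_eq_floor_add_integral hf hc hfb hm, hdiv, Int.floor_add_intCast, Int.fract_add_intCast,
    Int.floor_eq_zero_iff.mpr hb, Int.fract_eq_self.mpr hb, div_mul_cancel₀ _ hpi.ne', zero_add]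
  exact (congrArg _ hau).trans (Int.floor_add_fract u)

lemma cdf_qf [IsProbabilityMeasure m] (hf : Continuous f) (hc : 0 < c)
    (hfb : ∀ x ∈ Ico (0:ℝ) (2 * π), c ≤ f x)
    (hm : m = (volume.restrict (Ico (0:ℝ) (2 * π))).withDensity
      (fun x => ENNReal.ofReal (f x))) (u : ℝ) : cdf m (qf m u) = u := by
  obtain ⟨x, rfl⟩ := surjective_cdf hf hc.le hfb hm u
  rw [qf_cdf_of_strictMono (strictMono_cdf hf hc hfb hm)]

lemma lipschitzWith_qf [IsProbabilityMeasure m] (hf : Continuous f) (hc : 0 < c)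
    (hfb : ∀ x ∈ Ico (0:ℝ) (2 * π), c ≤ f x)
    (hm : m = (volume.restrict (Ico (0:ℝ) (2 * π))).withDensity
      (fun x => ENNReal.ofReal (f x))) : LipschitzWith (Real.toNNReal c⁻¹) (qf m) := by
  refine LipschitzWith.of_le_add_mul _ fun u v => ?_
  rw [Real.coe_toNNReal _ (inv_nonneg.mpr hc.le), Real.dist_eq, ← sub_le_iff_le_add',
    ← div_eq_inv_mul, le_div_iff₀' hc]
  rcases le_total (qf m v) (qf m u) with h | h
  · have := mul_sub_le_cdf_sub hf hc.le hfb hm h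
    rw [cdf_qf hf hc hfb hm, cdf_qf hf hc hfb hm] at this
    exact this.trans (le_abs_self _)
  · exact (mul_nonpos_of_nonneg_of_nonpos hc.le (sub_nonpos.mpr h)).trans (abs_nonneg _)

lemma cdf_zero (m : Measure ℝ) : cdf m 0 = 0 := by simp [cdf]

lemma cdf_two_pi (m : Measure ℝ) : cdf m (2 * π) = 1 := by
  simpa [cdf_zero] using cdf_add_two_pi m 0

lemma hasDerivAt_cdf (hf : Continuous f) (hc : 0 ≤ c)
    (hfb : ∀ x ∈ Ico (0:ℝ) (2 * π), c ≤ f x)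
    (hm : m = (volume.restrict (Ico (0:ℝ) (2 * π))).withDensity
      (fun x => ENNReal.ofReal (f x))) {x : ℝ} (hx : x ∈ Ioo 0 (2 * π)) :
    HasDerivAt (cdf m) (f x) x := by
  have hpi : 0 < 2 * π := by positivity
  refine (hf.integral_hasStrictDerivAt 0 x).hasDerivAt.congr_of_eventuallyEq ?_
  filter_upwards [Ioo_mem_nhds hx.1 hx.2] with y hy
  have hb : y / (2 * π) ∈ Ico (0:ℝ) 1 :=
    ⟨div_nonneg hy.1.le hpi.le, (div_lt_one hpi).mpr hy.2⟩
  rw [cdf_eq_floor_add_integral hf hc hfb hm, Int.floor_eq_zero_iff.mpr hb,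
    Int.fract_eq_self.mpr hb, div_mul_cancel₀ _ hpi.ne', Int.cast_zero, zero_add]

lemma image_cdf_Ioo [IsProbabilityMeasure m] (hf : Continuous f) (hc : 0 < c)
    (hfb : ∀ x ∈ Ico (0:ℝ) (2 * π), c ≤ f x)
    (hm : m = (volume.restrict (Ico (0:ℝ) (2 * π))).withDensity
      (fun x => ENNReal.ofReal (f x))) : cdf m '' Ioo 0 (2 * π) = Ioo 0 1 := by
  have hmono := strictMono_cdf hf hc hfb hm
  ext u
  constructor
  · rintro ⟨x, hx, rfl⟩
    rw [← cdf_zero m, ← cdf_two_pi m]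
    exact ⟨hmono hx.1, hmono hx.2⟩
  · intro hu
    obtain ⟨x, rfl⟩ := surjective_cdf hf hc.le hfb hm u
    rw [← cdf_zero m, ← cdf_two_pi m] at hu
    exact ⟨x, ⟨hmono.lt_iff_lt.mp hu.1, hmono.lt_iff_lt.mp hu.2⟩, rfl⟩

lemma deriv_qf_cdf [IsProbabilityMeasure m] (hf : Continuous f) (hc : 0 < c)
    (hfb : ∀ x ∈ Ico (0:ℝ) (2 * π), c ≤ f x)
    (hm : m = (volume.restrict (Ico (0:ℝ) (2 * π))).withDensity
      (fun x => ENNReal.ofReal (f x))) {x : ℝ} (hx : x ∈ Ioo 0 (2 * π)) :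
    deriv (qf m) (cdf m x) = (f x)⁻¹ := by
  have hfx : f x ≠ 0 := (hc.trans_le (hfb x ⟨hx.1.le, hx.2⟩)).ne'
  have hinv := qf_cdf_of_strictMono (strictMono_cdf hf hc hfb hm) x
  refine (HasDerivAt.of_local_left_inverse (f := cdf m)
    (lipschitzWith_qf hf hc hfb hm).continuous.continuousAt ?_ hfx
    (Eventually.of_forall (cdf_qf hf hc hfb hm))).deriv
  rw [hinv]
  exact hasDerivAt_cdf hf hc.le hfb hm hx

/-- Substituting `u = cdf m x` removes the derivative of the quantile function. -/
lemma integral_mul_deriv_qf [IsProbabilityMeasure m] (hf : Continuous f) (hc : 0 < c)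
    (hfb : ∀ x ∈ Ico (0:ℝ) (2 * π), c ≤ f x)
    (hm : m = (volume.restrict (Ico (0:ℝ) (2 * π))).withDensity
      (fun x => ENNReal.ofReal (f x))) (φ : ℝ → ℝ) :
    ∫ u in (0:ℝ)..1, φ u * deriv (qf m) u = ∫ x in (0:ℝ)..2 * π, φ (cdf m x) := by
  rw [intervalIntegral.integral_of_le zero_le_one, integral_Ioc_eq_integral_Ioo,
    intervalIntegral.integral_of_le (by positivity), integral_Ioc_eq_integral_Ioo,
    ← image_cdf_Ioo hf hc hfb hm,
    integral_image_eq_integral_abs_deriv_smul measurableSet_Ioo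
      (fun x hx => (hasDerivAt_cdf hf hc.le hfb hm hx).hasDerivWithinAt)
      (strictMono_cdf hf hc hfb hm).injective.injOn]
  refine setIntegral_congr_fun measurableSet_Ioo fun x hx => ?_
  have hfx : 0 < f x := hc.trans_le (hfb x ⟨hx.1.le, hx.2⟩)
  simp only [deriv_qf_cdf hf hc hfb hm hx, abs_of_pos hfx, smul_eq_mul]
  field_simp

end Density

/-- Differentiation of the `L²` cost between a Lipschitz quasi-periodic function and a translate
of a monotone quasi-periodic function. -/
lemma hasDerivAt_integral_sq_sub_translate {G H : ℝ → ℝ} {K : NNReal} {T : ℝ}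
    (hG : LipschitzWith K G) (hG1 : ∀ u, G (u + 1) = G u + T)
    (hH : Monotone H) (hH1 : ∀ u, H (u + 1) = H u + T) (θ : ℝ) :
    HasDerivAt (fun t => ∫ u in (0:ℝ)..1, (G u - H (u - t)) ^ 2)
      (∫ u in (0:ℝ)..1, 2 * (G u - H (u - θ)) * deriv G u) θ := by
  have hshift (g : ℝ → ℝ) (hg : Function.Periodic g 1) (t : ℝ) :
      ∫ u in (0:ℝ)..1, g u = ∫ v in (0:ℝ)..1, g (v + t) := by
    rw [intervalIntegral.integral_comp_add_right]
    simpa [add_comm] using hg.intervalIntegral_add_eq 0 t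
  have hcost : (fun t => ∫ u in (0:ℝ)..1, (G u - H (u - t)) ^ 2) =
      fun t => ∫ v in (0:ℝ)..1, (G (v + t) - H v) ^ 2 := by
    funext t
    rw [hshift _ _ t]
    · simp only [add_sub_cancel_right]
    · intro u
      simp only [hG1, show u + 1 - t = u - t + 1 by ring, hH1, add_sub_add_right_eq_sub]
  have hderiv1 (u : ℝ) : deriv G (u + 1) = deriv G u := by
    rw [← deriv_comp_add_const, funext hG1, deriv_add_const]
  have hderiv : ∫ u in (0:ℝ)..1, 2 * (G u - H (u - θ)) * deriv G u =
      ∫ v in (0:ℝ)..1, 2 * (G (v + θ) - H v) * deriv G (v + θ) := by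
    rw [hshift _ _ θ]
    · simp only [add_sub_cancel_right]
    · intro u
      simp only [hG1, show u + 1 - θ = u - θ + 1 by ring, hH1, add_sub_add_right_eq_sub, hderiv1]
  rw [hcost, hderiv]
  have hGc := hG.continuous
  have hGm := hGc.measurable
  have hHm := hH.measurable
  have hmeas (t : ℝ) : Measurable fun v => (G (v + t) - H v) ^ 2 := by fun_prop
  set M : ℝ := |G 0| + K * (|θ| + 2) + (|H 0| + |H 1|)
  have hbound (t : ℝ) (ht : t ∈ Metric.ball θ 1) (v : ℝ) (hv : v ∈ uIoc (0:ℝ) 1) :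
      |G (v + t) - H v| ≤ M := by
    rw [uIoc_of_le zero_le_one] at hv
    rw [Metric.mem_ball, Real.dist_eq] at ht
    have h1 : |G (v + t)| ≤ |G 0| + K * (|θ| + 2) := by
      have h2 := hG.dist_le_mul (v + t) 0
      rw [Real.dist_eq, Real.dist_eq, sub_zero] at h2
      have h3 : |v + t| ≤ |θ| + 2 := by
        have : |v + t| ≤ |v| + |t| := abs_add_le _ _
        have : |t| ≤ |t - θ| + |θ| := by simpa using abs_add_le (t - θ) θ
        have : |v| ≤ 1 := abs_le.mpr ⟨by linarith [hv.1], hv.2⟩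
        linarith
      have h4 : (K : ℝ) * |v + t| ≤ K * (|θ| + 2) := by gcongr
      have : |G (v + t)| ≤ |G (v + t) - G 0| + |G 0| := by
        simpa using abs_add_le (G (v + t) - G 0) (G 0)
      linarith
    have h2 : |H v| ≤ |H 0| + |H 1| := by
      rw [abs_le]
      have := hH hv.1.le
      have := hH hv.2
      constructor <;>
        linarith [neg_abs_le (H 0), le_abs_self (H 1), abs_nonneg (H 0), abs_nonneg (H 1)]
    exact (abs_sub _ _).trans (add_le_add h1 h2)
  have hM0 : 0 ≤ M := by positivity
  refine (intervalIntegral.hasDerivAt_integral_of_dominated_loc_of_lip (μ := volume)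
    (bound := fun _ => K * (2 * M)) (Metric.ball_mem_nhds θ one_pos)
    (Eventually.of_forall fun t => (hmeas t).aestronglyMeasurable) ?_ ?_ ?_
    intervalIntegrable_const ?_).2
  · refine (intervalIntegrable_const (c := M ^ 2)).mono_fun' (hmeas θ).aestronglyMeasurable ?_
    refine (ae_restrict_iff' measurableSet_uIoc).mpr (ae_of_all _ fun v hv => ?_)
    dsimp only
    rw [Real.norm_eq_abs, abs_pow]
    exact pow_le_pow_left₀ (abs_nonneg _)
      (hbound θ (Metric.mem_ball_self one_pos) v hv) 2
  · have hd := measurable_deriv G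
    exact Measurable.aestronglyMeasurable (by fun_prop)
  · refine ae_of_all _ fun v hv => LipschitzOnWith.of_dist_le_mul fun x hx y hy => ?_
    have hx' := hbound x hx v hv
    have hy' := hbound y hy v hv
    have hlip := hG.dist_le_mul (v + x) (v + y)
    rw [Real.dist_eq, dist_add_left] at hlip
    rw [Real.coe_nnabs, abs_of_nonneg (by positivity), Real.dist_eq, sq_sub_sq, abs_mul,
      sub_sub_sub_cancel_right]
    calc |G (v + x) - H v + (G (v + y) - H v)| * |G (v + x) - G (v + y)|
        ≤ (2 * M) * (K * dist x y) := by
          gcongr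
          exact (abs_add_le _ _).trans (by linarith)
      _ = K * (2 * M) * dist x y := by ring
  · have hae : ∀ᵐ v : ℝ, DifferentiableAt ℝ G (v + θ) :=
      (measurePreserving_add_right volume θ).quasiMeasurePreserving.ae
        hG.ae_differentiableAt_real
    filter_upwards [hae] with v hv _
    have h1 : HasDerivAt (fun t => G (v + t)) (deriv G (v + θ)) θ :=
      hv.hasDerivAt.comp_const_add v θ
    simpa using (h1.sub_const (H v)).fun_pow 2

/-- If `μ̃` has a continuous density bounded below away from zero on
`[0,2π)`, then `θ ↦ C_{[μ,ν]}(θ)` is differentiable with derivative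
`−2 ∫₀^{2π} (T̃_θ(u) − u) du`, where `T̃_θ(u) = F_ν̃⁻(F_μ̃(u) − θ)`. -/
theorem stmt12 (μ ν : Measure S1) [IsProbabilityMeasure μ] [IsProbabilityMeasure ν]
    (f : ℝ → ℝ) (hf : Continuous f) (c : ℝ) (hc : 0 < c)
    (hfb : ∀ x ∈ Set.Ico (0:ℝ) (2 * π), c ≤ f x)
    (hdens : tilde μ =
      (volume.restrict (Set.Ico (0:ℝ) (2 * π))).withDensity (fun x => ENNReal.ofReal (f x)))
    (θ : ℝ) :
    HasDerivAt (cost μ ν)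
      (-2 * ∫ u in (0:ℝ)..(2 * π), (qf (tilde ν) (cdf (tilde μ) u - θ) - u)) θ := by
  have := isProbabilityMeasure_tilde μ
  have := isProbabilityMeasure_tilde ν
  have h := hasDerivAt_integral_sq_sub_translate (lipschitzWith_qf hf hc hfb hdens)
    (qf_add_one (tilde μ)) (monotone_qf (tilde ν)) (qf_add_one (tilde ν)) θ
  rw [integral_mul_deriv_qf hf hc hfb hdens] at h
  refine h.congr_deriv ?_
  rw [← intervalIntegral.integral_const_mul]
  refine intervalIntegral.integral_congr fun x _ => ?_
  simp only [qf_cdf_of_strictMono (strictMono_cdf hf hc hfb hdens)]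
  ring

end
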